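/- Assume t > 2, the integers g₁, t₁ and d₁ are all odd, gcd(d₁, t₁) = 1, gcd(n₁, 2t₁) = 1, and there exists an integer x with n₁x² + d₁ ≡ 0 (mod 2t₁). Then N(n,d,t) = w₊(t₁)·φ(w₋(t₁))·2^{ρ(t₁)}. -/

import Mathlib

/-- `wplus w t₁` is the largest divisor of `w` all of whose prime factors divide `t₁`:
the product of the prime powers `p ^ (v_p w)` over primes `p` dividing `gcd(w, t₁)`. -/
def wplus (w t₁ : ℕ) : ℕ :=
  ∏ p ∈ w.primeFactors ∩ t₁.primeFactors, p ^ (w.factorization p)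

/-- `wminus w t₁ = w / wplus w t₁`. -/
def wminus (w t₁ : ℕ) : ℕ := w / wplus w t₁

/-- A multiplicative isomorphism preserves the number of units that square to one. -/
theorem Units.card_sq_eq_one_congr {R S : Type*} [Monoid R] [Monoid S] (e : R ≃* S) :
    Nat.card {u : Rˣ // u ^ 2 = 1} = Nat.card {u : Sˣ // u ^ 2 = 1} :=
  Nat.card_congr ((Units.mapEquiv e).toEquiv.subtypeEquiv fun u => by
    simp [← map_pow])

theorem Units.card_sq_eq_one_prod (R S : Type*) [Monoid R] [Monoid S] :
    Nat.card {u : (R × S)ˣ // u ^ 2 = 1} =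
      Nat.card {u : Rˣ // u ^ 2 = 1} * Nat.card {u : Sˣ // u ^ 2 = 1} := by
  rw [← Nat.card_prod]
  refine Nat.card_congr ((MulEquiv.prodUnits.toEquiv.subtypeEquiv
    (q := fun v : Rˣ × Sˣ => v.1 ^ 2 = 1 ∧ v.2 ^ 2 = 1) fun u => ?_).trans
    (Equiv.subtypeProdEquivProd (p := fun a : Rˣ => a ^ 2 = 1) (q := fun b : Sˣ => b ^ 2 = 1)))
  rw [← MulEquiv.map_eq_one_iff (MulEquiv.prodUnits (M := R) (N := S)), map_pow, Prod.ext_iff]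
  rfl

theorem ZMod.units_sq_eq_one_iff_of_odd_prime_pow {p k : ℕ} (hp : p.Prime) (hp2 : p ≠ 2)
    (u : (ZMod (p ^ k))ˣ) : u ^ 2 = 1 ↔ u = 1 ∨ u = -1 := by
  refine ⟨fun h => ?_, by rintro (rfl | rfl) <;> simp⟩
  obtain ⟨a, ha⟩ := ZMod.intCast_surjective (u : ZMod (p ^ k))
  have hdvd : ((p ^ k : ℕ) : ℤ) ∣ (a - 1) * (a + 1) := by
    rw [← ZMod.intCast_zmod_eq_zero_iff_dvd]
    have h' : (u : ZMod (p ^ k)) ^ 2 = 1 := by rw [← Units.val_pow_eq_pow_val, h, Units.val_one]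
    push_cast
    rw [ha]
    linear_combination h'
  have hpZ : Prime (p : ℤ) := Nat.prime_iff_prime_int.mp hp
  push_cast at hdvd
  have hcases : (p : ℤ) ^ k ∣ a - 1 ∨ (p : ℤ) ^ k ∣ a + 1 := by
    by_cases h1 : (p : ℤ) ∣ a - 1
    · have h2 : ¬ (p : ℤ) ∣ a + 1 := fun h2 => by
        have h3 : (p : ℤ) ∣ 2 := by simpa using (dvd_sub h2 h1).trans (by ring_nf; rfl)
        exact hp2 ((Nat.prime_dvd_prime_iff_eq hp Nat.prime_two).mp (by exact_mod_cast h3))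
      exact .inl ((hpZ.coprime_iff_not_dvd.mpr h2).pow_left.dvd_of_dvd_mul_right hdvd)
    · exact .inr ((hpZ.coprime_iff_not_dvd.mpr h1).pow_left.dvd_of_dvd_mul_left hdvd)
  refine hcases.imp (fun h => ?_) fun h => ?_ <;>
  · have h' := (ZMod.intCast_zmod_eq_zero_iff_dvd _ (p ^ k)).mpr (by exact_mod_cast h)
    push_cast at h'
    rw [ha] at h'
    ext
    push_cast
    linear_combination h'

theorem ZMod.card_units_sq_eq_one_of_odd_prime_pow {p k : ℕ} (hp : p.Prime) (hp2 : p ≠ 2)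
    (hk : 0 < k) : Nat.card {u : (ZMod (p ^ k))ˣ // u ^ 2 = 1} = 2 := by
  have hlt : 2 < p ^ k := (lt_of_le_of_ne hp.two_le hp2.symm).trans_le (Nat.le_self_pow hk.ne' p)
  have : Fact (2 < p ^ k) := ⟨hlt⟩
  have hne : (1 : (ZMod (p ^ k))ˣ) ≠ -1 := fun h =>
    ZMod.neg_one_ne_one (n := p ^ k) (by simpa using (congrArg Units.val h).symm)
  have hset : {u : (ZMod (p ^ k))ˣ | u ^ 2 = 1} = {1, -1} := by
    ext u
    simpa using ZMod.units_sq_eq_one_iff_of_odd_prime_pow hp hp2 u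
  have hcard := Set.ncard_pair hne
  rw [← hset] at hcard
  exact hcard

theorem ZMod.card_units_sq_eq_one_of_odd (m : ℕ) (hm : Odd m) :
    Nat.card {u : (ZMod m)ˣ // u ^ 2 = 1} = 2 ^ m.primeFactors.card := by
  induction m using Nat.recOnPosPrimePosCoprime with
  | prime_pow p k hp hk =>
    have hp2 : p ≠ 2 := by
      rintro rfl
      exact absurd hm (by simp [Nat.even_pow, hk.ne'])
    rw [ZMod.card_units_sq_eq_one_of_odd_prime_pow hp hp2 hk, Nat.primeFactors_prime_pow hk.ne' hp]
    simp
  | zero => simp at hm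
  | one =>
    have : Unique {u : (ZMod 1)ˣ // u ^ 2 = 1} :=
      { default := ⟨1, one_pow 2⟩, uniq := fun u => Subsingleton.elim _ _ }
    simp
  | coprime a b ha hb hab iha ihb =>
    obtain ⟨hao, hbo⟩ := Nat.odd_mul.mp hm
    rw [Units.card_sq_eq_one_congr (ZMod.chineseRemainder hab).toMulEquiv,
      Units.card_sq_eq_one_prod, iha hao, ihb hbo, hab.primeFactors_mul,
      Finset.card_union_of_disjoint hab.disjoint_primeFactors, pow_add]

theorem MonoidHom.card_filter_mem_mul_card {G H : Type*} [Group G] [Group H] [Fintype G]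
    [Fintype H] [DecidableEq H] (f : G →* H) (hf : Function.Surjective f) (S : Finset H) :
    (Finset.univ.filter fun x => f x ∈ S).card * Fintype.card H = S.card * Fintype.card G := by
  have hfib (y : H) : (Finset.univ.filter fun x => f x = y).card =
      (Finset.univ.filter fun x => f x = 1).card :=
    MonoidHom.card_fiber_eq_of_mem_range f (hf y) (hf 1)
  have hG : Fintype.card G =
      Fintype.card H * (Finset.univ.filter fun x => f x = 1).card := by
    rw [← Finset.card_univ, Finset.card_eq_sum_card_fiberwise (f := f) (t := Finset.univ)
      (by simp [Set.MapsTo]), Finset.sum_congr rfl fun y _ => hfib y]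
    simp
  have hS : (Finset.univ.filter fun x => f x ∈ S).card =
      S.card * (Finset.univ.filter fun x => f x = 1).card := by
    rw [← Finset.sum_card_fiberwise_eq_card_filter, Finset.sum_congr rfl fun y _ => hfib y]
    simp
  rw [hS, hG]
  ring

theorem CommGroup.card_sq_eq_sq {G : Type*} [CommGroup G] [Fintype G] [DecidableEq G] (a : G) :
    (Finset.univ.filter fun u : G => u ^ 2 = a ^ 2).card = Nat.card {u : G // u ^ 2 = 1} := by
  rw [← Fintype.card_subtype, ← Nat.card_eq_fintype_card]
  refine Nat.card_congr ((Equiv.divRight a).subtypeEquiv fun u => ?_)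
  simp [div_pow, div_eq_one]

theorem wplus_mul_prod_sdiff {w : ℕ} (hw : w ≠ 0) (m : ℕ) :
    wplus w m * ∏ p ∈ w.primeFactors \ m.primeFactors, p ^ w.factorization p = w := by
  rw [wplus, Finset.prod_inter_mul_prod_sdiff]
  exact Nat.prod_factorization_pow_eq_self hw

theorem wminus_eq_prod_sdiff {w : ℕ} (hw : w ≠ 0) (m : ℕ) :
    wminus w m = ∏ p ∈ w.primeFactors \ m.primeFactors, p ^ w.factorization p := by
  have h := wplus_mul_prod_sdiff hw m
  have hpos : 0 < wplus w m := Nat.pos_of_ne_zero fun h0 => hw (by rw [← h, h0, zero_mul])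
  rw [wminus]
  exact Nat.div_eq_of_eq_mul_right hpos h.symm

theorem wplus_mul_wminus {w : ℕ} (hw : w ≠ 0) (m : ℕ) : wplus w m * wminus w m = w := by
  rw [wminus_eq_prod_sdiff hw, wplus_mul_prod_sdiff hw]

theorem primeFactors_wplus_subset (w m : ℕ) : (wplus w m).primeFactors ⊆ m.primeFactors := by
  intro q hq
  have hqp := Nat.prime_of_mem_primeFactors hq
  obtain ⟨p, hp, hqp'⟩ := (hqp.prime.dvd_finsetProd_iff _).mp (Nat.dvd_of_mem_primeFactors hq)
  rw [Finset.mem_inter] at hp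
  rw [(Nat.prime_dvd_prime_iff_eq hqp (Nat.prime_of_mem_primeFactors hp.1)).mp
    (hqp.dvd_of_dvd_pow hqp')]
  exact hp.2

theorem coprime_wminus {w m : ℕ} (hw : w ≠ 0) (hm : m ≠ 0) : Nat.Coprime m (wminus w m) := by
  rw [wminus_eq_prod_sdiff hw]
  refine Nat.Coprime.prod_right fun p hp => Nat.Coprime.pow_right _ ?_
  rw [Finset.mem_sdiff] at hp
  have hpp := Nat.prime_of_mem_primeFactors hp.1
  refine ((Nat.Prime.coprime_iff_not_dvd hpp).mpr fun h => hp.2 ?_).symm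
  exact Nat.mem_primeFactors.mpr ⟨hpp, h, hm⟩

theorem coprime_wplus_wminus {w m : ℕ} (hw : w ≠ 0) (hm : m ≠ 0) :
    Nat.Coprime (wplus w m) (wminus w m) := by
  refine Nat.Coprime.prod_left fun p hp => Nat.Coprime.pow_left _ ?_
  exact (coprime_wminus hw hm).coprime_dvd_left
    (Nat.dvd_of_mem_primeFactors (Finset.mem_inter.mp hp).2)

theorem Nat.totient_mul_of_primeFactors_subset {a m : ℕ} (ha : a ≠ 0) (hm : m ≠ 0)
    (h : a.primeFactors ⊆ m.primeFactors) : Nat.totient (a * m) = a * Nat.totient m := by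
  have hpf : (a * m).primeFactors = m.primeFactors := by
    rw [Nat.primeFactors_mul ha hm, Finset.union_eq_right.mpr h]
  have h1 := Nat.totient_mul_prod_primeFactors (a * m)
  have h2 := Nat.totient_mul_prod_primeFactors m
  rw [hpf] at h1
  have hpos : 0 < ∏ p ∈ m.primeFactors, p :=
    Finset.prod_pos fun p hp => (Nat.prime_of_mem_primeFactors hp).pos
  refine Nat.eq_of_mul_eq_mul_right hpos ?_
  rw [h1, mul_assoc a, mul_assoc a, h2]

theorem totient_mul_eq_wplus_mul {w m : ℕ} (hw : w ≠ 0) (hm : m ≠ 0) :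
    Nat.totient (w * m) = wplus w m * Nat.totient (wminus w m) * Nat.totient m := by
  have hp : wplus w m ≠ 0 := fun h => hw (by rw [← wplus_mul_wminus hw m, h, zero_mul])
  have hcop : Nat.Coprime (wplus w m * m) (wminus w m) :=
    (coprime_wplus_wminus hw hm).mul_left (coprime_wminus hw hm)
  calc Nat.totient (w * m) = Nat.totient (wplus w m * m * wminus w m) := by
        rw [mul_right_comm, wplus_mul_wminus hw]
    _ = _ := by
        rw [Nat.totient_mul hcop,
          Nat.totient_mul_of_primeFactors_subset hp hm (primeFactors_wplus_subset w m)]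
        ring

/-- Counting residues coprime to `t` that satisfy `P` amounts to counting units of `ZMod t`. -/
theorem card_range_coprime_filter {t : ℕ} [NeZero t] (P : ℕ → Prop) [DecidablePred P] :
    ((Finset.range t).filter fun c => Nat.gcd c t = 1 ∧ P c).card =
      (Finset.univ.filter fun u : (ZMod t)ˣ => P (u : ZMod t).val).card := by
  refine (Finset.card_bij (fun (u : (ZMod t)ˣ) _ => (u : ZMod t).val) ?_ ?_ ?_).symm
  · intro u hu
    simp only [Finset.mem_filter, Finset.mem_univ, true_and] at hu
    simp only [Finset.mem_filter, Finset.mem_range]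
    exact ⟨ZMod.val_lt _, ZMod.val_coe_unit_coprime u, hu⟩
  · intro u _ v _ h
    exact Units.ext (ZMod.val_injective t h)
  · intro c hc
    simp only [Finset.mem_filter, Finset.mem_range] at hc
    have hval : ((ZMod.unitOfCoprime c hc.2.1 : (ZMod t)ˣ) : ZMod t).val = c := by
      rw [ZMod.coe_unitOfCoprime, ZMod.val_natCast_of_lt hc.1]
    exact ⟨ZMod.unitOfCoprime c hc.2.1, Finset.mem_filter.mpr ⟨Finset.mem_univ _, hval.symm ▸ hc.2.2⟩,
      hval⟩

/-- When `n x² ≡ -d` modulo `m` with `n` and `d` coprime to `m`, some unit `y` of `ZMod m` has the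
property that `m ∣ d + c² n` exactly when `c² ≡ y²`. -/
theorem exists_unit_forall_dvd_iff_sq_eq {m n d : ℕ} (hn : Nat.Coprime n m)
    (hd : Nat.Coprime d m) {x : ℤ} (hx : (m : ℤ) ∣ (n : ℤ) * x ^ 2 + (d : ℤ)) :
    ∃ y : (ZMod m)ˣ, ∀ c : ℤ, (m : ℤ) ∣ (d : ℤ) + c ^ 2 * (n : ℤ) ↔
      (c : ZMod m) ^ 2 = (y : ZMod m) ^ 2 := by
  have hx' := (ZMod.intCast_zmod_eq_zero_iff_dvd _ m).mpr hx
  push_cast at hx'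
  have hnu : IsUnit (n : ZMod m) := (ZMod.isUnit_iff_coprime n m).mpr hn
  have hdu : IsUnit (d : ZMod m) := (ZMod.isUnit_iff_coprime d m).mpr hd
  have hxu : IsUnit (x : ZMod m) := by
    have h : (n : ZMod m) * (x : ZMod m) ^ 2 = -d := by linear_combination hx'
    have h2 := hdu.neg
    rw [← h] at h2
    exact (isUnit_pow_iff two_ne_zero).mp (isUnit_of_mul_isUnit_right h2)
  obtain ⟨y, hy⟩ := hxu
  refine ⟨y, fun c => ?_⟩
  rw [← ZMod.intCast_zmod_eq_zero_iff_dvd, hy]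
  push_cast
  refine ⟨fun h => hnu.mul_left_cancel ?_, fun h => ?_⟩
  · linear_combination h - hx'
  · linear_combination hx' + (n : ZMod m) * h

/-- (see paper, Theorem on |Υ_n^{d,t}|)
`N(n,d,t)` is the number of residue classes `c` mod `t` with `gcd(c,t) = 1` and
`2t₁ ∣ g₁(d₁ + c²n₁)`. -/
theorem count_case_B_t_large
    (n d t g₀ d₁ n₁ g w g₁ t₁ : ℕ)
    (hn : 2 ≤ n) (hd : 1 ≤ d) (ht : 2 < t)
    (hg₀ : g₀ = Nat.gcd (2 * d) (2 * n + 2))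
    (htdvd : t ∣ g₀)
    (hd₁ : d₁ = 2 * d / g₀) (hn₁ : n₁ = (2 * n + 2) / g₀)
    (hg : g = g₀ / t) (hw : w = Nat.gcd g t)
    (hg₁ : g₁ = g / w) (ht₁ : t₁ = t / w)
    (hg₁odd : Odd g₁) (ht₁odd : Odd t₁) (hd₁odd : Odd d₁)
    (hd₁t₁ : Nat.gcd d₁ t₁ = 1) (hn₁2t₁ : Nat.gcd n₁ (2 * t₁) = 1)
    (hQR : ∃ x : ℤ, (2 * (t₁ : ℤ)) ∣ ((n₁ : ℤ) * x ^ 2 + (d₁ : ℤ))) :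
    ((Finset.range t).filter
        (fun c : ℕ => Nat.gcd c t = 1 ∧
          (2 * (t₁ : ℤ)) ∣ ((g₁ : ℤ) * ((d₁ : ℤ) + (c : ℤ) ^ 2 * (n₁ : ℤ))))).card
      = wplus w t₁ * Nat.totient (wminus w t₁) * 2 ^ t₁.primeFactors.card := by
  have hg₀pos : 0 < g₀ := hg₀ ▸ Nat.gcd_pos_of_pos_left _ (by omega)
  have hgt : g * t = g₀ := hg ▸ Nat.div_mul_cancel htdvd
  have hgpos : 0 < g := Nat.pos_of_ne_zero fun h => by simp [h] at hgt; omega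
  have hwpos : 0 < w := hw ▸ Nat.gcd_pos_of_pos_left _ hgpos
  have hwt : w * t₁ = t := ht₁ ▸ Nat.mul_div_cancel' (hw ▸ Nat.gcd_dvd_right g t)
  have hwg : w * g₁ = g := hg₁ ▸ Nat.mul_div_cancel' (hw ▸ Nat.gcd_dvd_left g t)
  have ht₁pos : 0 < t₁ := ht₁odd.pos
  have hcop : Nat.Coprime t₁ g₁ := by
    rw [ht₁, hg₁, hw]
    exact (Nat.coprime_div_gcd_div_gcd (hw ▸ hwpos)).symm
  have hteven : Even t := by
    have h2 : Even (g * t) := by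
      rw [hgt, hg₀, even_iff_two_dvd]
      exact Nat.dvd_gcd ⟨d, rfl⟩ ⟨n + 1, by ring⟩
    by_contra hodd
    rw [Nat.not_even_iff_odd] at hodd
    have hwodd : Odd w := (Nat.odd_mul.mp (hwt ▸ hodd)).1
    have hgodd : Odd g := hwg ▸ hwodd.mul hg₁odd
    exact Nat.not_even_iff_odd.mpr (hgodd.mul hodd) h2
  have hn₁cop : Nat.Coprime n₁ 2 ∧ Nat.Coprime n₁ t₁ := Nat.coprime_mul_iff_right.mp hn₁2t₁
  have hn₁odd : Odd n₁ := Nat.coprime_two_right.mp hn₁cop.1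
  have : NeZero t := ⟨by omega⟩
  have : NeZero t₁ := ⟨ht₁pos.ne'⟩
  have htt : t₁ ∣ t := ⟨w, by rw [← hwt, mul_comm]⟩
  obtain ⟨x, hx⟩ := hQR
  obtain ⟨y, hy⟩ := exists_unit_forall_dvd_iff_sq_eq hn₁cop.2 hd₁t₁
    ((Dvd.intro_left 2 rfl).trans hx)
  have hiff (u : (ZMod t)ˣ) :
      (2 * (t₁ : ℤ)) ∣ ((g₁ : ℤ) * ((d₁ : ℤ) + ((u : ZMod t).val : ℤ) ^ 2 * (n₁ : ℤ))) ↔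
        ZMod.unitsMap htt u ∈ Finset.univ.filter fun v : (ZMod t₁)ˣ => v ^ 2 = y ^ 2 := by
    have hcodd : Odd (u : ZMod t).val :=
      Nat.coprime_two_right.mp
        ((ZMod.val_coe_unit_coprime u).coprime_dvd_right hteven.two_dvd)
    have hsum : (2 : ℤ) ∣ (d₁ : ℤ) + ((u : ZMod t).val : ℤ) ^ 2 * (n₁ : ℤ) := by
      exact_mod_cast (hd₁odd.add_odd (hcodd.pow.mul hn₁odd)).two_dvd
    have h2t₁ : IsCoprime (2 : ℤ) (t₁ : ℤ) :=
      Nat.isCoprime_iff_coprime.mpr (Nat.coprime_two_left.mpr ht₁odd)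
    have hmul : (2 * (t₁ : ℤ)) ∣
          ((g₁ : ℤ) * ((d₁ : ℤ) + ((u : ZMod t).val : ℤ) ^ 2 * (n₁ : ℤ))) ↔
        (t₁ : ℤ) ∣ (d₁ : ℤ) + ((u : ZMod t).val : ℤ) ^ 2 * (n₁ : ℤ) :=
      ⟨fun h => (Nat.isCoprime_iff_coprime.mpr hcop).dvd_of_dvd_mul_left
          ((Dvd.intro_left 2 rfl).trans h),
        fun h => (h2t₁.mul_dvd hsum h).mul_left _⟩
    rw [hmul, hy]
    simp [Units.ext_iff, ZMod.unitsMap_val]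
  rw [card_range_coprime_filter (fun c : ℕ =>
    (2 * (t₁ : ℤ)) ∣ ((g₁ : ℤ) * ((d₁ : ℤ) + (c : ℤ) ^ 2 * (n₁ : ℤ))))]
  simp_rw [hiff]
  have htot := totient_mul_eq_wplus_mul hwpos.ne' ht₁pos.ne'
  rw [hwt] at htot
  have hcard := MonoidHom.card_filter_mem_mul_card (ZMod.unitsMap htt)
    (ZMod.unitsMap_surjective htt) (Finset.univ.filter fun v : (ZMod t₁)ˣ => v ^ 2 = y ^ 2)
  rw [CommGroup.card_sq_eq_sq, ZMod.card_units_sq_eq_one_of_odd t₁ ht₁odd,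
    ZMod.card_units_eq_totient, ZMod.card_units_eq_totient, htot] at hcard
  refine Nat.eq_of_mul_eq_mul_right (Nat.totient_pos.mpr ht₁pos) ?_
  linear_combination hcard
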